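/- Let σ > 0 and let ℒ_σ = σΔ − ⟨x,∇⟩ be the Ornstein–Uhlenbeck operator on ℝⁿ. Suppose B : (0,∞)^m → (0,∞) is twice differentiable, increasing in each variable, and there exists λ ≥ 0 such that D²B(x) ≤ λ·diag(∂₁B(x)/x₁, …, ∂_mB(x)/x_m) for all x ∈ (0,∞)^m. Let U₁,…,U_m : (0,∞) × ℝⁿ → (0,∞) be smooth with ∂_t U_j ≥ ℒ_σ U_j and D²(log U_j) ≥ 0 (spatial log-convexity) pointwise for all j. Then Ũ := B(U₁,…,U_m) satisfies ∂_t Ũ ≥ ℒ_{σ/(1+λ)} Ũ pointwise. Moreover, if Θ(x₁,…,x_m) := log B(e^{x₁},…,e^{x_m}) is convex, then D²(log Ũ) ≥ 0 pointwise. -/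

import Mathlib

noncomputable section
open Real MeasureTheory Matrix Set

/-- Partial derivative of `f` in the `i`-th coordinate direction. -/
def pd {ι : Type*} [Fintype ι] [DecidableEq ι] (f : (ι → ℝ) → ℝ) (i : ι) (x : ι → ℝ) : ℝ :=
  fderiv ℝ f x (Pi.single i 1)

/-- Spatial gradient. -/
def grad' {ι : Type*} [Fintype ι] [DecidableEq ι] (f : (ι → ℝ) → ℝ) (x : ι → ℝ) : ι → ℝ :=
  fun i => pd f i x

/-- Hessian matrix. -/
def hess' {ι : Type*} [Fintype ι] [DecidableEq ι] (f : (ι → ℝ) → ℝ) (x : ι → ℝ) :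
    Matrix ι ι ℝ :=
  Matrix.of fun i j => pd (fun y => pd f j y) i x

/-- Spatial Laplacian. -/
def lap' {ι : Type*} [Fintype ι] [DecidableEq ι] (f : (ι → ℝ) → ℝ) (x : ι → ℝ) : ℝ :=
  ∑ i, hess' f x i i

/-- The Ornstein–Uhlenbeck operator `ℒ_σ f = σΔf - ⟨x,∇f⟩` applied in space. -/
def ouOp {ι : Type*} [Fintype ι] [DecidableEq ι] (σ : ℝ) (f : (ι → ℝ) → ℝ)
    (x : ι → ℝ) : ℝ :=
  σ * lap' f x - x ⬝ᵥ grad' f x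

section PartialDerivatives

variable {ι κ : Type*} [Fintype ι] [Fintype κ]

theorem ContDiffAt.differentiableAt_fderiv {f : (ι → ℝ) → ℝ} {x : ι → ℝ}
    (hf : ContDiffAt ℝ 2 f x) : DifferentiableAt ℝ (fderiv ℝ f) x :=
  (hf.fderiv_right (m := 1) (by norm_num)).differentiableAt (by norm_num)

theorem ContDiffAt.eventually_differentiableAt {f : (ι → ℝ) → ℝ} {x : ι → ℝ}
    (hf : ContDiffAt ℝ 2 f x) : ∀ᶠ y in nhds x, DifferentiableAt ℝ f y :=
  (hf.eventually (by simp)).mono fun _ hy => hy.differentiableAt (by norm_num)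

theorem ConvexOn.fderiv_fderiv_nonneg {f : (ι → ℝ) → ℝ} (hc : ConvexOn ℝ Set.univ f)
    (hf : ContDiff ℝ 2 f) (x v : ι → ℝ) : 0 ≤ fderiv ℝ (fderiv ℝ f) x v v := by
  have hline : ∀ s : ℝ, HasDerivAt (fun s : ℝ => x + s • v) v s := fun s => by
    simpa using ((hasDerivAt_id s).smul_const v).const_add x
  have h0 : x + (0 : ℝ) • v = x := by simp
  have h1 : ∀ s : ℝ, HasDerivAt (fun s : ℝ => f (x + s • v)) (fderiv ℝ f (x + s • v) v) s :=
    fun s => (hf.differentiable (by norm_num) _).hasFDerivAt.comp_hasDerivAt s (hline s)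
  have h2 : HasDerivAt (fun s : ℝ => fderiv ℝ f (x + s • v) v)
      (fderiv ℝ (fderiv ℝ f) x v v) 0 := by
    have h : HasFDerivAt (fderiv ℝ f) (fderiv ℝ (fderiv ℝ f) x) (x + (0 : ℝ) • v) := by
      rw [h0]
      exact hf.contDiffAt.differentiableAt_fderiv.hasFDerivAt
    have h' : HasDerivAt (fun s : ℝ => fderiv ℝ f (x + s • v)) (fderiv ℝ (fderiv ℝ f) x v) 0 :=
      h.comp_hasDerivAt (0 : ℝ) (hline 0)
    simpa using h'.clm_apply (hasDerivAt_const (0 : ℝ) v)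
  have hconv : ConvexOn ℝ Set.univ (fun s : ℝ => f (x + s • v)) := by
    have := hc.comp_affineMap (AffineMap.lineMap x (x + v) : ℝ →ᵃ[ℝ] (ι → ℝ))
    simpa [Function.comp_def, AffineMap.lineMap_apply, add_comm] using this
  have hmono : Monotone (fun s : ℝ => fderiv ℝ f (x + s • v) v) := by
    have := hconv.monotoneOn_deriv fun s _ => (h1 s).differentiableAt
    rw [funext fun s => (h1 s).deriv] at this
    exact monotoneOn_univ.1 this
  rw [← h2.deriv]
  exact hmono.deriv_nonneg

variable [DecidableEq ι]

theorem Filter.EventuallyEq.pd_eq {f g : (ι → ℝ) → ℝ} {x : ι → ℝ} (h : f =ᶠ[nhds x] g) (i : ι) :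
    pd f i x = pd g i x := by
  rw [pd, pd, h.fderiv_eq]

theorem fderiv_apply_eq_sum_pd (f : (ι → ℝ) → ℝ) (x v : ι → ℝ) :
    fderiv ℝ f x v = ∑ i, pd f i x * v i := by
  conv_lhs => rw [pi_eq_sum_univ' v]
  simp only [map_sum, map_smul, smul_eq_mul, pd]
  exact Finset.sum_congr rfl fun i _ => mul_comm _ _

theorem pd_mul {f g : (ι → ℝ) → ℝ} {x : ι → ℝ} (hf : DifferentiableAt ℝ f x)
    (hg : DifferentiableAt ℝ g x) (i : ι) :
    pd (fun y => f y * g y) i x = f x * pd g i x + pd f i x * g x := by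
  simp only [pd]
  rw [fderiv_fun_mul hf hg]
  simp [mul_comm]

theorem pd_sum {f : κ → (ι → ℝ) → ℝ} {x : ι → ℝ} (hf : ∀ j, DifferentiableAt ℝ (f j) x) (i : ι) :
    pd (fun y => ∑ j, f j y) i x = ∑ j, pd (f j) i x := by
  simp only [pd]
  rw [fderiv_fun_sum fun j _ => hf j]
  simp

theorem pd_log {f : (ι → ℝ) → ℝ} {x : ι → ℝ} (hf : DifferentiableAt ℝ f x) (h0 : f x ≠ 0)
    (i : ι) : pd (fun y => Real.log (f y)) i x = (f x)⁻¹ * pd f i x := by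
  rw [pd, fderiv.log hf h0]
  rfl

theorem ContDiffAt.differentiableAt_pd {f : (ι → ℝ) → ℝ} {x : ι → ℝ}
    (hf : ContDiffAt ℝ 2 f x) (i : ι) : DifferentiableAt ℝ (fun y => pd f i y) x :=
  hf.differentiableAt_fderiv.clm_apply (differentiableAt_const _)

theorem hess'_eq_fderiv_fderiv {f : (ι → ℝ) → ℝ} {x : ι → ℝ} (hf : ContDiffAt ℝ 2 f x) (i j : ι) :
    hess' f x i j = fderiv ℝ (fderiv ℝ f) x (Pi.single i 1) (Pi.single j 1) := by
  have h := hf.differentiableAt_fderiv.hasFDerivAt.clm_apply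
    (hasFDerivAt_const (Pi.single j (1 : ℝ) : ι → ℝ) x)
  simp only [hess', Matrix.of_apply]
  rw [pd]
  simp only [pd]
  rw [h.fderiv]
  simp

theorem hess'_log {f : (ι → ℝ) → ℝ} {x : ι → ℝ} (hf : ContDiffAt ℝ 2 f x) (h0 : f x ≠ 0)
    (i k : ι) : hess' (fun y => Real.log (f y)) x i k =
      (f x)⁻¹ * hess' f x i k - pd f i x * pd f k x / f x ^ 2 := by
  have hd : DifferentiableAt ℝ f x := hf.differentiableAt (by norm_num)
  have h : (fun y => pd (fun y => Real.log (f y)) k y) =ᶠ[nhds x]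
      fun y => (f y)⁻¹ * pd f k y := by
    filter_upwards [hf.eventually_differentiableAt, hf.continuousAt.eventually_ne h0] with y h1 h2
    exact pd_log h1 h2 k
  have hinv : pd (fun y => (f y)⁻¹) i x = -(f x ^ 2)⁻¹ * pd f i x := by
    have := (hasDerivAt_inv h0).comp_hasFDerivAt x hd.hasFDerivAt
    simp only [Function.comp_def] at this
    rw [pd, this.fderiv]
    rfl
  simp only [hess', Matrix.of_apply]
  rw [h.pd_eq, pd_mul (hd.fun_inv h0) (hf.differentiableAt_pd k), hinv]
  ring

theorem ConvexOn.posSemidef_hess' {f : (ι → ℝ) → ℝ} (hc : ConvexOn ℝ Set.univ f)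
    (hf : ContDiff ℝ 2 f) (x : ι → ℝ) : (hess' f x).PosSemidef := by
  refine Matrix.PosSemidef.of_dotProduct_mulVec_nonneg ?_ fun v => ?_
  · ext i j
    simp only [Matrix.conjTranspose_apply, star_trivial]
    rw [hess'_eq_fderiv_fderiv hf.contDiffAt, hess'_eq_fderiv_fderiv hf.contDiffAt]
    exact (hf.contDiffAt.isSymmSndFDerivAt (by simp)).eq _ _
  · have hv : v = ∑ i, v i • Pi.single i (1 : ℝ) := by
      ext j
      simp [Finset.sum_apply, Pi.single_apply]
    have h := hc.fderiv_fderiv_nonneg hf x v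
    have e : star v ⬝ᵥ (hess' f x *ᵥ v) = fderiv ℝ (fderiv ℝ f) x v v := by
      conv_rhs => rw [hv]
      simp only [map_sum, map_smul, _root_.sum_apply, _root_.smul_apply,
        smul_eq_mul, dotProduct, Matrix.mulVec, star_trivial, hess'_eq_fderiv_fderiv hf.contDiffAt]
      simp only [Finset.mul_sum]
      rw [Finset.sum_comm]
      exact Finset.sum_congr rfl fun i _ => Finset.sum_congr rfl fun j _ => by ring
    rwa [e]

variable [DecidableEq κ]

theorem pd_comp {F : (κ → ℝ) → ℝ} {V : κ → (ι → ℝ) → ℝ} {x : ι → ℝ}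
    (hF : DifferentiableAt ℝ F (fun j => V j x)) (hV : ∀ j, DifferentiableAt ℝ (V j) x) (i : ι) :
    pd (fun y => F (fun j => V j y)) i x = ∑ j, pd F j (fun j => V j x) * pd (V j) i x := by
  have h : HasFDerivAt (fun y => F (fun j => V j y)) _ x :=
    HasFDerivAt.comp x hF.hasFDerivAt (hasFDerivAt_pi.2 fun j => (hV j).hasFDerivAt)
  rw [pd, h.fderiv, ContinuousLinearMap.comp_apply, fderiv_apply_eq_sum_pd]
  rfl

theorem hess'_comp {F : (κ → ℝ) → ℝ} {V : κ → (ι → ℝ) → ℝ} {x : ι → ℝ}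
    (hF : ContDiffAt ℝ 2 F (fun j => V j x)) (hV : ∀ j, ContDiffAt ℝ 2 (V j) x) (i k : ι) :
    hess' (fun y => F (fun j => V j y)) x i k =
      ∑ j, pd F j (fun j => V j x) * hess' (V j) x i k +
      ∑ j, ∑ l, pd (V l) i x * hess' F (fun j => V j x) l j * pd (V j) k x := by
  have hVd : ∀ j, DifferentiableAt ℝ (V j) x := fun j => (hV j).differentiableAt (by norm_num)
  have hVc : ContinuousAt (fun y j => V j y) x :=
    continuousAt_pi.2 fun j => (hV j).continuousAt
  have h : (fun y => pd (fun y => F (fun j => V j y)) k y) =ᶠ[nhds x]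
      fun y => ∑ j, pd F j (fun j => V j y) * pd (V j) k y := by
    filter_upwards [hVc.eventually hF.eventually_differentiableAt,
      Filter.eventually_all.2 fun j => (hV j).eventually_differentiableAt] with y h1 h2
    exact pd_comp h1 h2 k
  have hFd : ∀ j, DifferentiableAt ℝ (fun y => pd F j (fun j => V j y)) x := fun j =>
    DifferentiableAt.comp x (f := fun y j => V j y) (hF.differentiableAt_pd j)
      (differentiableAt_pi.2 hVd)
  simp only [hess', Matrix.of_apply]
  rw [h.pd_eq, pd_sum fun j => (hFd j).fun_mul ((hV j).differentiableAt_pd k),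
    ← Finset.sum_add_distrib]
  refine Finset.sum_congr rfl fun j _ => ?_
  rw [pd_mul (hFd j) ((hV j).differentiableAt_pd k),
    pd_comp (F := fun z => pd F j z) (hF.differentiableAt_pd j) hVd, Finset.sum_mul]
  congr 1
  exact Finset.sum_congr rfl fun l _ => by ring

theorem lap'_comp_le {B : (κ → ℝ) → ℝ} {U : κ → (ι → ℝ) → ℝ} {x : ι → ℝ} {lam : ℝ}
    (hlam : 0 ≤ lam) (hB : ContDiffAt ℝ 2 B (fun j => U j x))
    (hB_mono : ∀ j, 0 ≤ pd B j (fun j => U j x))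
    (hB_hess : (lam • Matrix.diagonal (fun j => pd B j (fun j => U j x) / U j x) -
      hess' B (fun j => U j x)).PosSemidef)
    (hU : ∀ j, ContDiffAt ℝ 2 (U j) x) (hU_pos : ∀ j, 0 < U j x)
    (hU_log : ∀ j, (hess' (fun y => Real.log (U j y)) x).PosSemidef) :
    lap' (fun y => B (fun j => U j y)) x ≤
      (1 + lam) * ∑ j, pd B j (fun j => U j x) * lap' (U j) x := by
  have hquad : ∀ i, ∑ j, ∑ l, pd (U l) i x * hess' B (fun j => U j x) l j * pd (U j) i x ≤
      ∑ j, lam * (pd B j (fun j => U j x) / U j x * pd (U j) i x ^ 2) := fun i => by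
    have h := hB_hess.dotProduct_mulVec_nonneg (fun j => pd (U j) i x)
    rw [Matrix.sub_mulVec, dotProduct_sub, Matrix.smul_mulVec, sub_nonneg] at h
    refine le_of_eq_of_le ?_ (h.trans_eq ?_)
    · simp only [dotProduct, Matrix.mulVec, star_trivial, Finset.mul_sum]
      rw [Finset.sum_comm]
      exact Finset.sum_congr rfl fun j _ => Finset.sum_congr rfl fun l _ => by ring
    · simp only [dotProduct, star_trivial, Pi.smul_apply, smul_eq_mul, Matrix.mulVec_diagonal]
      exact Finset.sum_congr rfl fun j _ => by ring
  have hlap : ∀ j, ∑ i, pd (U j) i x ^ 2 / U j x ≤ lap' (U j) x := fun j => by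
    refine Finset.sum_le_sum fun i _ => ?_
    have h := (hU_log j).diag_nonneg (i := i)
    rw [hess'_log (hU j) (hU_pos j).ne'] at h
    have h' := mul_nonneg (hU_pos j).le h
    have e : U j x * ((U j x)⁻¹ * hess' (U j) x i i - pd (U j) i x * pd (U j) i x / U j x ^ 2) =
        hess' (U j) x i i - pd (U j) i x ^ 2 / U j x := by
      have := (hU_pos j).ne'
      field_simp
    linarith
  calc lap' (fun y => B (fun j => U j y)) x
      ≤ ∑ i, (∑ j, pd B j (fun j => U j x) * hess' (U j) x i i +
          ∑ j, lam * (pd B j (fun j => U j x) / U j x * pd (U j) i x ^ 2)) :=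
        Finset.sum_le_sum fun i _ => by
          rw [hess'_comp hB hU]
          exact add_le_add_right (hquad i) _
    _ = ∑ j, (pd B j (fun j => U j x) * lap' (U j) x +
          lam * (pd B j (fun j => U j x) * ∑ i, pd (U j) i x ^ 2 / U j x)) := by
        rw [Finset.sum_add_distrib, Finset.sum_add_distrib, Finset.sum_comm]
        congr 1
        · simp only [lap', Finset.mul_sum]
        · rw [Finset.sum_comm]
          simp only [Finset.mul_sum]
          exact Finset.sum_congr rfl fun j _ => Finset.sum_congr rfl fun i _ => by ring
    _ ≤ ∑ j, (pd B j (fun j => U j x) * lap' (U j) x +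
          lam * (pd B j (fun j => U j x) * lap' (U j) x)) :=
        Finset.sum_le_sum fun j _ => add_le_add_right
          (mul_le_mul_of_nonneg_left (mul_le_mul_of_nonneg_left (hlap j) (hB_mono j)) hlam) _
    _ = _ := by
        rw [Finset.sum_add_distrib, ← Finset.mul_sum]
        ring

theorem posSemidef_hess'_comp {F : (κ → ℝ) → ℝ} {V : κ → (ι → ℝ) → ℝ} {x : ι → ℝ}
    (hF : ContDiffAt ℝ 2 F (fun j => V j x)) (hF_mono : ∀ j, 0 ≤ pd F j (fun j => V j x))
    (hF_hess : (hess' F (fun j => V j x)).PosSemidef) (hV : ∀ j, ContDiffAt ℝ 2 (V j) x)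
    (hV_hess : ∀ j, (hess' (V j) x).PosSemidef) :
    (hess' (fun y => F (fun j => V j y)) x).PosSemidef := by
  let G : Matrix κ ι ℝ := Matrix.of fun j i => pd (V j) i x
  have e : hess' (fun y => F (fun j => V j y)) x =
      ∑ j, pd F j (fun j => V j x) • hess' (V j) x + Gᴴ * hess' F (fun j => V j x) * G := by
    ext i k
    rw [hess'_comp hF hV]
    simp [Matrix.sum_apply, Matrix.mul_apply, Finset.sum_mul, G]
  rw [e]
  exact (Matrix.posSemidef_sum _ fun j _ => (hV_hess j).smul (hF_mono j)).add
    (hF_hess.conjTranspose_mul_mul_same G)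

end PartialDerivatives

/-- Ornstein–Uhlenbeck analogue of the general concavity closure property: for log-convex
supersolutions `U_j` of `∂ₜU = ℒ_σU`, the function `Ũ = B(U₁,…,U_m)` is a supersolution of
`∂ₜU = ℒ_{σ/(1+λ)}U`, and if `Θ` is convex then `Ũ` is log-convex in space. -/
theorem ou_general_concavity_closure
    {n m : ℕ} (σ : ℝ) (hσ : 0 < σ)
    (B : (Fin m → ℝ) → ℝ)
    (hB_smooth : ContDiffOn ℝ 2 B {x | ∀ i, 0 < x i})
    (hB_pos : ∀ x, (∀ i, 0 < x i) → 0 < B x)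
    (hB_mono : ∀ x, (∀ i, (0:ℝ) < x i) → ∀ j, 0 ≤ pd B j x)
    (lam : ℝ) (hlam : 0 ≤ lam)
    (hB_hess : ∀ x, (∀ i, (0:ℝ) < x i) →
      (lam • Matrix.diagonal (fun j => pd B j x / x j) - hess' B x).PosSemidef)
    (U : Fin m → ℝ → (Fin n → ℝ) → ℝ)
    (hU_smooth : ∀ j, ContDiffOn ℝ (⊤ : ℕ∞) (Function.uncurry (U j)) (Set.Ioi (0:ℝ) ×ˢ Set.univ))
    (hU_pos : ∀ j, ∀ t > (0:ℝ), ∀ x, 0 < U j t x)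
    (hU_super : ∀ j, ∀ t > (0:ℝ), ∀ x,
      deriv (fun s => U j s x) t ≥ ouOp σ (U j t) x)
    (hU_logconvex : ∀ j, ∀ t > (0:ℝ), ∀ x,
      (hess' (fun y => Real.log (U j t y)) x).PosSemidef)
    (Util : ℝ → (Fin n → ℝ) → ℝ)
    (hUtil : Util = fun t x => B (fun j => U j t x)) :
    (∀ t > (0:ℝ), ∀ x,
      deriv (fun s => Util s x) t ≥ ouOp (σ / (1 + lam)) (Util t) x)
    ∧ (ConvexOn ℝ Set.univ
        (fun x : Fin m → ℝ => Real.log (B (fun i => Real.exp (x i)))) →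
       ∀ t > (0:ℝ), ∀ x,
        (hess' (fun y => Real.log (Util t y)) x).PosSemidef) := by
  subst hUtil
  have hopen : IsOpen {x : Fin m → ℝ | ∀ i, 0 < x i} := by
    simp only [Set.ofPred_forall]
    exact isOpen_iInter_of_finite fun i => isOpen_lt continuous_const (continuous_apply i)
  have hB : ∀ x : Fin m → ℝ, (∀ i, 0 < x i) → ContDiffAt ℝ 2 B x := fun x hx =>
    hB_smooth.contDiffAt (hopen.mem_nhds hx)
  have hUat : ∀ j, ∀ t > (0 : ℝ), ∀ x, ContDiffAt ℝ (⊤ : ℕ∞) (Function.uncurry (U j)) (t, x) :=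
    fun j t ht x => (hU_smooth j).contDiffAt ((isOpen_Ioi.prod isOpen_univ).mem_nhds ⟨ht, trivial⟩)
  have hUx : ∀ j, ∀ t > (0 : ℝ), ∀ x, ContDiffAt ℝ 2 (U j t) x := fun j t ht x =>
    (ContDiffAt.comp x (hUat j t ht x) (contDiffAt_const.prodMk contDiffAt_id)).of_le
      (WithTop.coe_le_coe.2 (le_top : (2 : ℕ∞) ≤ ⊤))
  have hUt : ∀ j, ∀ t > (0 : ℝ), ∀ x, DifferentiableAt ℝ (fun s => U j s x) t :=
    fun j t ht x => (ContDiffAt.comp t (f := fun s => (s, x)) (hUat j t ht x)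
      (contDiffAt_id.prodMk contDiffAt_const)).differentiableAt (by simp)
  refine ⟨fun t ht x => ?_, fun hconv t ht x => ?_⟩
  · have hp : ∀ j, 0 < U j t x := fun j => hU_pos j t ht x
    have hBd : DifferentiableAt ℝ B (fun j => U j t x) := (hB _ hp).differentiableAt (by norm_num)
    have hderiv : deriv (fun s => B (fun j => U j s x)) t =
        ∑ j, pd B j (fun j => U j t x) * deriv (fun s => U j s x) t := by
      have h : HasDerivAt (fun s => B (fun j => U j s x)) _ t :=
        HasFDerivAt.comp_hasDerivAt t hBd.hasFDerivAt
          (hasDerivAt_pi.2 fun j => (hUt j t ht x).hasDerivAt)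
      rw [h.deriv, fderiv_apply_eq_sum_pd]
    have hlap := lap'_comp_le hlam (hB _ hp) (hB_mono _ hp) (hB_hess _ hp)
      (fun j => hUx j t ht x) hp (fun j => hU_logconvex j t ht x)
    have hgrad : x ⬝ᵥ grad' (fun y => B (fun j => U j t y)) x =
        ∑ j, pd B j (fun j => U j t x) * (x ⬝ᵥ grad' (U j t) x) := by
      simp only [dotProduct, grad', Finset.mul_sum]
      rw [Finset.sum_comm]
      refine Finset.sum_congr rfl fun i _ => ?_
      rw [pd_comp hBd fun j => (hUx j t ht x).differentiableAt (by norm_num), Finset.mul_sum]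
      exact Finset.sum_congr rfl fun j _ => by ring
    have hsuper : ∑ j, pd B j (fun j => U j t x) * ouOp σ (U j t) x ≤
        ∑ j, pd B j (fun j => U j t x) * deriv (fun s => U j s x) t :=
      Finset.sum_le_sum fun j _ =>
        mul_le_mul_of_nonneg_left (hU_super j t ht x) (hB_mono _ hp j)
    have hou : ∑ j, pd B j (fun j => U j t x) * ouOp σ (U j t) x =
        σ * ∑ j, pd B j (fun j => U j t x) * lap' (U j t) x -
        ∑ j, pd B j (fun j => U j t x) * (x ⬝ᵥ grad' (U j t) x) := by
      rw [Finset.mul_sum, ← Finset.sum_sub_distrib]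
      exact Finset.sum_congr rfl fun j _ => by rw [ouOp]; ring
    have hl : 0 < 1 + lam := by linarith
    have hscale := mul_le_mul_of_nonneg_left hlap (div_pos hσ hl).le
    rw [← mul_assoc, div_mul_cancel₀ _ hl.ne'] at hscale
    simp only [hderiv, ge_iff_le]
    rw [ouOp, hgrad]
    linarith
  · let Θ : (Fin m → ℝ) → ℝ := fun z => Real.log (B (fun i => Real.exp (z i)))
    have hexp : ∀ z : Fin m → ℝ, ∀ i, 0 < Real.exp (z i) := fun z i => Real.exp_pos _
    have hBexp : ContDiff ℝ 2 fun z : Fin m → ℝ => B (fun i => Real.exp (z i)) :=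
      contDiff_iff_contDiffAt.2 fun z => ContDiffAt.comp z
        (f := fun (z : Fin m → ℝ) i => Real.exp (z i)) (hB _ (hexp z)) (by fun_prop)
    have hΘ : ContDiff ℝ 2 Θ := hBexp.log fun z => (hB_pos _ (hexp z)).ne'
    have hΘ_mono : ∀ z j, 0 ≤ pd Θ j z := fun z j => by
      rw [pd_log (hBexp.differentiable (by norm_num) z) (hB_pos _ (hexp z)).ne',
        pd_comp (V := fun (i : Fin m) (z : Fin m → ℝ) => Real.exp (z i))
          ((hB _ (hexp z)).differentiableAt (by norm_num)) (fun i => by fun_prop)]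
      refine mul_nonneg (inv_nonneg.2 (hB_pos _ (hexp z)).le) (Finset.sum_nonneg fun i _ =>
        mul_nonneg (hB_mono _ (hexp z) i) ?_)
      have h : HasFDerivAt (fun z : Fin m → ℝ => Real.exp (z i)) _ z :=
        (hasFDerivAt_apply i z).exp
      rw [pd, h.fderiv]
      by_cases hij : i = j <;> simp [hij, (Real.exp_pos _).le]
    have e : (fun y => Real.log (B (fun j => U j t y))) =
        fun y => Θ (fun j => Real.log (U j t y)) := by
      funext y
      simp only [Θ, Real.exp_log (hU_pos _ t ht y)]
    simp only [e]
    exact posSemidef_hess'_comp hΘ.contDiffAt (hΘ_mono _) (hconv.posSemidef_hess' hΘ _)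
      (fun j => (hUx j t ht x).log (hU_pos j t ht x).ne') (fun j => hU_logconvex j t ht x)
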